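/- (Corollary 1: LP-based lower bound.) Assume f_s ≥ 0 and c_s ≥ 0 componentwise for every stage s, λ_s ∈ [0,1] and α_s ∈ [0,1) for s = 2,…,T, and every B_s has nonnegative entries. Let (x^L, y^L, η^L, u^L) be an optimal solution of the LP relaxation of the two-stage model (x^L : 𝒯 → ℝ^M, x^L_n ≥ 0), i.e. feasible for it with objective value ≤ that of every tuple feasible for it. Set b_n = B_{τ(n)} y^L_n, b̄_n = max_{l∈𝒯_{τ(n)}} b_l, and define: x^MS_r = ⌈b_r⌉, x^MS_n = max_{m∈𝒫(n)} ⌈b_m⌉ − max_{m∈𝒫(a(n))} ⌈b_m⌉ (n ≠ r), η^MS_n = max_{m∈𝒞(n)} ( f_{τ(m)}·∑_{l∈𝒫(m)} x^MS_l + c_{τ(m)}·y^L_m − u^L_m ) (n ∉ ℒ); and x^TS_r = b_r, x^TS_n = max_{m∈𝒫(n)} b̄_m − max_{m∈𝒫(a(n))} b̄_m (n ≠ r), η^TS_n = max_{m∈𝒞(n)} ( f_{τ(m)}·∑_{l∈𝒫(m)} x^TS_l + c_{τ(m)}·y^L_m − u^L_m ) (n ∉ ℒ). Let z^TS and z^MS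 be the infima of F over the two-stage-feasible and multistage-feasible tuples respectively (both real: the feasible sets are nonempty and F ≥ 0 on them). Then z^TS − z^MS ≥ f_1·( b_r − ⌈b_r⌉ ) + ∑_{n≠r} p_n (1−λ_{τ(n)}) f_{τ(n)} · ( max_{m∈𝒫(n)} b̄_m − max_{m∈𝒫(n)} ⌈b_m⌉ ) + ∑_{n∉ℒ} p_n λ_{τ(n)+1} ( η^TS_n − η^MS_n ). -/

import Mathlib

open Finset

/-- A scenario tree with `T` stages: a finite nonempty set of nodes with a root,
a parent map fixing the root, a stage map decreasing by one along the parent map,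
such that every node reaches the root by iterating the parent map, and every
non-leaf node has a child. -/
structure STree (T : ℕ) : Type 1 where
  Node : Type
  fin : Fintype Node
  deceq : DecidableEq Node
  root : Node
  parent : Node → Node
  stage : Node → ℕ
  hT : 1 ≤ T
  parent_root : parent root = root
  stage_root : stage root = 1
  stage_ge : ∀ n, 1 ≤ stage n
  stage_le : ∀ n, stage n ≤ T
  stage_parent : ∀ n, n ≠ root → stage (parent n) = stage n - 1
  reaches_root : ∀ n, ∃ k, parent^[k] n = root
  children_ne : ∀ n, stage n ≠ T → ∃ m, m ≠ root ∧ parent m = n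

attribute [instance] STree.fin STree.deceq

namespace STree

variable {T : ℕ} (S : STree T)

/-- The path set `𝒫(n) = {aᵏ(n) : k ≥ 0}` of a node. -/
def path (n : S.Node) : Finset S.Node :=
  (Finset.range T).image fun k => S.parent^[k] n

theorem path_nonempty (n : S.Node) : (S.path n).Nonempty :=
  ⟨n, Finset.mem_image.mpr ⟨0, Finset.mem_range.mpr S.hT, rfl⟩⟩

/-- The children `𝒞(n)` of a node. -/
def children (n : S.Node) : Finset S.Node :=
  Finset.univ.filter fun m => m ≠ S.root ∧ S.parent m = n

theorem children_nonempty {n : S.Node} (h : S.stage n ≠ T) : (S.children n).Nonempty := by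
  obtain ⟨m, h1, h2⟩ := S.children_ne n h
  exact ⟨m, Finset.mem_filter.mpr ⟨Finset.mem_univ m, h1, h2⟩⟩

/-- The set `𝒯ₛ` of stage-`s` nodes. -/
def stageNodes (s : ℕ) : Finset S.Node :=
  Finset.univ.filter fun n => S.stage n = s

theorem stageNodes_self_nonempty (n : S.Node) : (S.stageNodes (S.stage n)).Nonempty :=
  ⟨n, Finset.mem_filter.mpr ⟨Finset.mem_univ n, rfl⟩⟩

end STree

section Constructions

variable {T M J : ℕ}

/-- `b_n = B_{τ(n)} ŷ_n` (componentwise). -/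
noncomputable def bvec (S : STree T) (B : ℕ → Matrix (Fin M) (Fin J) ℝ)
    (yh : S.Node → Fin J → ℝ) (n : S.Node) (i : Fin M) : ℝ :=
  (B (S.stage n)).mulVec (yh n) i

/-- Componentwise maximum of `b` over all nodes of the same stage as `n`
(used for `b̄_n = max_{l ∈ 𝒯_{τ(n)}} b_l`). -/
noncomputable def stageMax (S : STree T) (b : S.Node → Fin M → ℝ) (n : S.Node) (i : Fin M) : ℝ :=
  (S.stageNodes (S.stage n)).sup' (S.stageNodes_self_nonempty n) fun l => b l i

/-- `max_{m ∈ 𝒫(n)} ⌈b_m⌉` (componentwise). -/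
noncomputable def pmc (S : STree T) (b : S.Node → Fin M → ℝ) (n : S.Node) (i : Fin M) : ℤ :=
  (S.path n).sup' (S.path_nonempty n) fun m => ⌈b m i⌉

/-- `max_{m ∈ 𝒫(n)} b_m` (componentwise, no rounding). -/
noncomputable def pm (S : STree T) (b : S.Node → Fin M → ℝ) (n : S.Node) (i : Fin M) : ℝ :=
  (S.path n).sup' (S.path_nonempty n) fun m => b m i

end Constructions

section CapacityModel

variable {T M N J : ℕ}

/-- Multistage feasibility (with the capacity variables `x` taken real, for LP
relaxations; the integer model uses the coercion of an integer `x`). -/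
def MFeasR (S : STree T) (f : ℕ → Fin M → ℝ) (c : ℕ → Fin J → ℝ)
    (A : ℕ → Matrix (Fin N) (Fin J) ℝ) (B : ℕ → Matrix (Fin M) (Fin J) ℝ)
    (d : S.Node → Fin N → ℝ)
    (x : S.Node → Fin M → ℝ) (y : S.Node → Fin J → ℝ) (η u : S.Node → ℝ) : Prop :=
  (∀ n i, 0 ≤ x n i) ∧ (∀ n j, 0 ≤ y n j) ∧ (∀ n, n ≠ S.root → 0 ≤ u n) ∧
  (∀ n, (A (S.stage n)).mulVec (y n) = d n) ∧
  (∀ n i, (B (S.stage n)).mulVec (y n) i ≤ ∑ m ∈ S.path n, x m i) ∧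
  ∀ n, n ≠ S.root →
    (∑ i, f (S.stage n) i * ∑ m ∈ S.path n, x m i) + (∑ j, c (S.stage n) j * y n j)
      ≤ u n + η (S.parent n)

/-- The two-stage (non-anticipativity) constraint: capacity decisions agree on
nodes of the same stage. -/
def TSconstr (S : STree T) (x : S.Node → Fin M → ℝ) : Prop :=
  ∀ m n, S.stage m = S.stage n → x m = x n

/-- The risk-averse objective
`F(x,y,η,u) = ∑_n p_n ( f̃_n·∑_{m∈𝒫(n)} x_m + c̃_n·y_n + λ̃_n η_n + α̃_n u_n )`,
where `f̃, c̃, λ̃, α̃` are the derived ECRM coefficients. -/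
noncomputable def FR (S : STree T) (p : S.Node → ℝ) (f : ℕ → Fin M → ℝ) (c : ℕ → Fin J → ℝ)
    (lam alpha : ℕ → ℝ)
    (x : S.Node → Fin M → ℝ) (y : S.Node → Fin J → ℝ) (η u : S.Node → ℝ) : ℝ :=
  ∑ n, p n *
    ((∑ i, (if n = S.root then f 1 i else (1 - lam (S.stage n)) * f (S.stage n) i)
        * ∑ m ∈ S.path n, x m i)
     + (∑ j, (if n = S.root then c 1 j else (1 - lam (S.stage n)) * c (S.stage n) j) * y n j)
     + (if S.stage n = T then 0 else lam (S.stage n + 1)) * η n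
     + (if n = S.root then 0 else lam (S.stage n) / (1 - alpha (S.stage n))) * u n)

/-- Optimal value of the risk-averse multistage model (integer capacities). -/
noncomputable def zMS (S : STree T) (p : S.Node → ℝ) (f : ℕ → Fin M → ℝ) (c : ℕ → Fin J → ℝ)
    (A : ℕ → Matrix (Fin N) (Fin J) ℝ) (B : ℕ → Matrix (Fin M) (Fin J) ℝ)
    (d : S.Node → Fin N → ℝ) (lam alpha : ℕ → ℝ) : ℝ :=
  sInf {v : ℝ | ∃ (x : S.Node → Fin M → ℤ) (y : S.Node → Fin J → ℝ) (η u : S.Node → ℝ),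
    MFeasR S f c A B d (fun n i => (x n i : ℝ)) y η u ∧
    v = FR S p f c lam alpha (fun n i => (x n i : ℝ)) y η u}

/-- Optimal value of the risk-averse two-stage model (integer capacities). -/
noncomputable def zTS (S : STree T) (p : S.Node → ℝ) (f : ℕ → Fin M → ℝ) (c : ℕ → Fin J → ℝ)
    (A : ℕ → Matrix (Fin N) (Fin J) ℝ) (B : ℕ → Matrix (Fin M) (Fin J) ℝ)
    (d : S.Node → Fin N → ℝ) (lam alpha : ℕ → ℝ) : ℝ :=
  sInf {v : ℝ | ∃ (x : S.Node → Fin M → ℤ) (y : S.Node → Fin J → ℝ) (η u : S.Node → ℝ),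
    MFeasR S f c A B d (fun n i => (x n i : ℝ)) y η u ∧
    TSconstr S (fun n i => (x n i : ℝ)) ∧
    v = FR S p f c lam alpha (fun n i => (x n i : ℝ)) y η u}

end CapacityModel

namespace STree

variable {T : ℕ} (S : STree T)

theorem stage_eq_one_iff {n : S.Node} : S.stage n = 1 ↔ n = S.root := by
  refine ⟨fun h => ?_, fun h => h ▸ S.stage_root⟩
  by_contra hn
  have h1 := S.stage_parent n hn
  have h2 := S.stage_ge (S.parent n)
  omega

theorem two_le_stage {n : S.Node} (hn : n ≠ S.root) : 2 ≤ S.stage n := by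
  have h1 := S.stage_ge n
  have h2 : S.stage n ≠ 1 := fun h => hn (S.stage_eq_one_iff.mp h)
  omega

theorem stage_eq_parent_add_one {n : S.Node} (hn : n ≠ S.root) :
    S.stage n = S.stage (S.parent n) + 1 := by
  have h1 := S.stage_parent n hn
  have h2 := S.stage_ge n
  omega

theorem stage_parent_ne {n : S.Node} (hn : n ≠ S.root) : S.stage (S.parent n) ≠ T := by
  have h1 := S.stage_eq_parent_add_one hn
  have h2 := S.stage_le n
  omega

theorem iterate_parent_root (k : ℕ) : S.parent^[k] S.root = S.root :=
  Function.iterate_fixed S.parent_root k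

theorem stage_iterate_parent (n : S.Node) (k : ℕ) :
    S.stage (S.parent^[k] n) = max 1 (S.stage n - k) := by
  induction k generalizing n with
  | zero => have := S.stage_ge n; simp; omega
  | succ k ih =>
    rw [Function.iterate_succ_apply, ih]
    by_cases hn : n = S.root
    · subst hn; rw [S.parent_root, S.stage_root]; omega
    · rw [S.stage_parent n hn]; omega

theorem mem_path {n m : S.Node} : m ∈ S.path n ↔ ∃ k, S.parent^[k] n = m := by
  unfold path
  simp only [Finset.mem_image, Finset.mem_range]
  refine ⟨fun ⟨k, _, h⟩ => ⟨k, h⟩, fun ⟨k, h⟩ => ?_⟩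
  by_cases hk : k < T
  · exact ⟨k, hk, h⟩
  · have hT := S.hT
    have hle := S.stage_le n
    refine ⟨T - 1, by omega, ?_⟩
    have h1 : S.parent^[T - 1] n = S.root :=
      S.stage_eq_one_iff.mp (by rw [stage_iterate_parent]; omega)
    have h2 : S.parent^[k] n = S.root :=
      S.stage_eq_one_iff.mp (by rw [stage_iterate_parent]; omega)
    rw [h1, ← h, h2]

theorem self_mem_path (n : S.Node) : n ∈ S.path n := S.mem_path.mpr ⟨0, rfl⟩

theorem path_root : S.path S.root = {S.root} := by
  ext m
  simp [mem_path, iterate_parent_root, eq_comm]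

theorem path_eq_insert (n : S.Node) : S.path n = insert n (S.path (S.parent n)) := by
  ext m
  simp only [Finset.mem_insert, mem_path]
  constructor
  · rintro ⟨_ | k, h⟩
    · exact Or.inl h.symm
    · exact Or.inr ⟨k, h⟩
  · rintro (h | ⟨k, h⟩)
    · exact ⟨0, h.symm⟩
    · exact ⟨k + 1, h⟩

theorem notMem_path_parent {n : S.Node} (hn : n ≠ S.root) : n ∉ S.path (S.parent n) := by
  rw [mem_path]
  rintro ⟨k, h⟩
  have h1 := S.stage_iterate_parent (S.parent n) k
  have h2 := S.stage_eq_parent_add_one hn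
  have h3 := S.two_le_stage hn
  rw [h] at h1
  omega

theorem path_parent_subset (n : S.Node) : S.path (S.parent n) ⊆ S.path n := by
  rw [S.path_eq_insert n]
  exact Finset.subset_insert _ _

theorem path_subset_of_mem {n m : S.Node} (h : m ∈ S.path n) : S.path m ⊆ S.path n := by
  obtain ⟨k, rfl⟩ := S.mem_path.mp h
  intro l hl
  obtain ⟨j, rfl⟩ := S.mem_path.mp hl
  exact S.mem_path.mpr ⟨j + k, Function.iterate_add_apply _ _ _ _⟩

theorem sum_path {R : Type*} [AddCommMonoid R] {n : S.Node} (hn : n ≠ S.root) (x : S.Node → R) :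
    ∑ m ∈ S.path n, x m = x n + ∑ m ∈ S.path (S.parent n), x m := by
  rw [S.path_eq_insert n, Finset.sum_insert (S.notMem_path_parent hn)]

theorem mem_children {n m : S.Node} : m ∈ S.children n ↔ m ≠ S.root ∧ S.parent m = n := by
  simp [children]

theorem mem_stageNodes {s : ℕ} {n : S.Node} : n ∈ S.stageNodes s ↔ S.stage n = s := by
  simp [stageNodes]

theorem stageNodes_one : S.stageNodes 1 = {S.root} := by
  ext n
  simp [mem_stageNodes, stage_eq_one_iff]

/-- Induction along the tree from the root to the leaves. -/
theorem tree_induction {P : S.Node → Prop} (root : P S.root)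
    (step : ∀ n, n ≠ S.root → P (S.parent n) → P n) (n : S.Node) : P n := by
  induction hs : S.stage n using Nat.strong_induction_on generalizing n with
  | _ s ih =>
    by_cases hn : n = S.root
    · exact hn ▸ root
    · have := S.stage_eq_parent_add_one hn
      exact step n hn (ih _ (by omega) _ rfl)

/-- Path sums of the increments of `g` telescope to `g`. -/
theorem sum_path_eq_of_increments {R : Type*} [AddCommGroup R] (x g : S.Node → R)
    (hr : x S.root = g S.root) (hx : ∀ n, n ≠ S.root → x n = g n - g (S.parent n))
    (n : S.Node) : ∑ m ∈ S.path n, x m = g n := by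
  refine S.tree_induction (P := fun n => ∑ m ∈ S.path n, x m = g n) ?_ (fun n hn ih => ?_) n
  · rw [path_root, Finset.sum_singleton, hr]
  · rw [S.sum_path hn, ih, hx n hn, sub_add_cancel]

/-- Summing over nonroot nodes is summing over the children of each nonleaf node. -/
theorem sum_nonroot_eq_sum_children (g : S.Node → ℝ) :
    ∑ n ∈ Finset.univ.filter (fun n => S.stage n ≠ T), ∑ m ∈ S.children n, g m
      = ∑ m ∈ Finset.univ.filter (fun m => m ≠ S.root), g m := by
  rw [← Finset.sum_fiberwise_of_maps_to (s := Finset.univ.filter (fun m => m ≠ S.root))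
    (t := Finset.univ.filter (fun n => S.stage n ≠ T)) (g := S.parent)]
  · simp only [children, Finset.filter_filter]
  · intro m hm
    simp only [Finset.mem_filter, Finset.mem_univ, true_and] at hm ⊢
    exact S.stage_parent_ne hm

/-- Under nonanticipativity, cumulative capacities depend only on the stage. -/
theorem sum_path_eq_of_stage_eq {M : ℕ} {x : S.Node → Fin M → ℝ} (hx : TSconstr S x) (i : Fin M)
    (n : S.Node) :
    ∀ m, S.stage m = S.stage n → ∑ l ∈ S.path m, x l i = ∑ l ∈ S.path n, x l i := by
  refine S.tree_induction (P := fun n => ∀ m, S.stage m = S.stage n →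
    ∑ l ∈ S.path m, x l i = ∑ l ∈ S.path n, x l i) (fun m h => ?_) (fun n hn ih m h => ?_) n
  · rw [S.stage_root, stage_eq_one_iff] at h
    rw [h]
  · have hm : m ≠ S.root := by
      rintro rfl
      have := S.two_le_stage hn
      rw [S.stage_root] at h
      omega
    rw [S.sum_path hn, S.sum_path hm, hx m n h, ih]
    rw [S.stage_parent m hm, S.stage_parent n hn, h]

end STree

section PathMaxima

variable {T M : ℕ} (S : STree T) (b : S.Node → Fin M → ℝ)

theorem pm_root (i : Fin M) : pm S b S.root i = b S.root i := by
  unfold pm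
  refine le_antisymm (Finset.sup'_le _ _ fun m hm => ?_)
    (Finset.le_sup' (fun m => b m i) (S.self_mem_path _))
  rw [S.path_root, Finset.mem_singleton] at hm
  rw [hm]

theorem pmc_root (i : Fin M) : pmc S b S.root i = ⌈b S.root i⌉ := by
  unfold pmc
  refine le_antisymm (Finset.sup'_le _ _ fun m hm => ?_)
    (Finset.le_sup' (fun m => ⌈b m i⌉) (S.self_mem_path _))
  rw [S.path_root, Finset.mem_singleton] at hm
  rw [hm]

theorem stageMax_root (i : Fin M) : stageMax S b S.root i = b S.root i := by
  unfold stageMax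
  refine le_antisymm (Finset.sup'_le _ _ fun m hm => ?_)
    (Finset.le_sup' (fun m => b m i) (S.mem_stageNodes.mpr rfl))
  rw [S.mem_stageNodes, S.stage_root, S.stage_eq_one_iff] at hm
  rw [hm]

theorem pmc_parent_le (n : S.Node) (i : Fin M) : pmc S b (S.parent n) i ≤ pmc S b n i :=
  Finset.sup'_mono _ (S.path_parent_subset n) _

theorem le_pmc (n : S.Node) (i : Fin M) : b n i ≤ pmc S b n i :=
  (Int.le_ceil _).trans <| by
    exact_mod_cast Finset.le_sup' (fun m => ⌈b m i⌉) (S.self_mem_path n)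

/-- Nonanticipative nonnegative capacities covering `b` cover the path maxima of the
stagewise maxima of `b`. -/
theorem pm_stageMax_le_sum_path {x : S.Node → Fin M → ℝ} (hx0 : ∀ n i, 0 ≤ x n i)
    (hx : TSconstr S x) (hb : ∀ n i, b n i ≤ ∑ m ∈ S.path n, x m i) (n : S.Node) (i : Fin M) :
    pm S (stageMax S b) n i ≤ ∑ m ∈ S.path n, x m i := by
  refine Finset.sup'_le _ _ fun m hm => ?_
  calc stageMax S b m i ≤ ∑ l ∈ S.path m, x l i := Finset.sup'_le _ _ fun l hl => by
        rw [← S.sum_path_eq_of_stage_eq hx i m l (S.mem_stageNodes.mp hl)]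
        exact hb l i
    _ ≤ ∑ l ∈ S.path n, x l i :=
        Finset.sum_le_sum_of_subset_of_nonneg (S.path_subset_of_mem hm) fun l _ _ => hx0 l i

end PathMaxima

section Objective

variable {T M N J : ℕ} (S : STree T) {p : S.Node → ℝ} {f : ℕ → Fin M → ℝ} {c : ℕ → Fin J → ℝ}
  {lam alpha : ℕ → ℝ}

theorem FR_nonneg {A : ℕ → Matrix (Fin N) (Fin J) ℝ} {B : ℕ → Matrix (Fin M) (Fin J) ℝ}
    {d : S.Node → Fin N → ℝ} (hp : ∀ n, 0 ≤ p n)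
    (hpc : ∀ n, S.stage n ≠ T → ∑ m ∈ S.children n, p m = p n)
    (hf : ∀ s, 1 ≤ s → s ≤ T → ∀ i, 0 ≤ f s i)
    (hc : ∀ s, 1 ≤ s → s ≤ T → ∀ j, 0 ≤ c s j)
    (hlam : ∀ s, 2 ≤ s → s ≤ T → 0 ≤ lam s ∧ lam s ≤ 1)
    (halpha : ∀ s, 2 ≤ s → s ≤ T → 0 ≤ alpha s ∧ alpha s < 1)
    {x : S.Node → Fin M → ℝ} {y : S.Node → Fin J → ℝ} {η u : S.Node → ℝ}
    (h : MFeasR S f c A B d x y η u) : 0 ≤ FR S p f c lam alpha x y η u := by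
  obtain ⟨hx, hy, hu, -, -, hr⟩ := h
  have hX : ∀ n i, 0 ≤ ∑ m ∈ S.path n, x m i := fun n i => Finset.sum_nonneg fun m _ => hx m i
  have hη : ∑ n, p n * ((if S.stage n = T then 0 else lam (S.stage n + 1)) * η n)
      = ∑ m, if m = S.root then 0 else p m * (lam (S.stage m) * η (S.parent m)) := by
    calc _ = ∑ n ∈ Finset.univ.filter (fun n => S.stage n ≠ T),
          ∑ m ∈ S.children n, p m * (lam (S.stage m) * η (S.parent m)) := by
          rw [Finset.sum_filter]
          refine Finset.sum_congr rfl fun n _ => ?_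
          by_cases hn : S.stage n = T
          · simp [hn]
          · simp only [hn, if_false, ne_eq, not_false_eq_true, if_true]
            rw [← hpc n hn, Finset.sum_mul]
            refine Finset.sum_congr rfl fun m hm => ?_
            obtain ⟨hm1, rfl⟩ := S.mem_children.mp hm
            rw [S.stage_eq_parent_add_one hm1]
      _ = _ := by
          rw [S.sum_nonroot_eq_sum_children, Finset.sum_filter]
          refine Finset.sum_congr rfl fun m _ => ?_
          by_cases hm : m = S.root <;> simp [hm]
  unfold FR
  simp only [mul_add, Finset.sum_add_distrib, hη]
  simp only [← Finset.sum_add_distrib]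
  refine Finset.sum_nonneg fun n _ => ?_
  by_cases hn : n = S.root
  · simp only [hn, if_true, add_zero, zero_mul, mul_zero]
    exact add_nonneg
      (mul_nonneg (hp _) (Finset.sum_nonneg fun i _ => mul_nonneg (hf 1 le_rfl S.hT i) (hX _ i)))
      (mul_nonneg (hp _) (Finset.sum_nonneg fun j _ => mul_nonneg (hc 1 le_rfl S.hT j) (hy _ j)))
  · simp only [hn, if_false]
    have h2 := S.two_le_stage hn
    have hle := S.stage_le n
    obtain ⟨hl0, hl1⟩ := hlam _ h2 hle
    obtain ⟨ha0, ha1⟩ := halpha _ h2 hle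
    have hfX : ∀ i, 0 ≤ f (S.stage n) i * ∑ m ∈ S.path n, x m i := fun i =>
      mul_nonneg (hf _ (S.stage_ge n) hle i) (hX n i)
    have hcy : ∀ j, 0 ≤ c (S.stage n) j * y n j := fun j =>
      mul_nonneg (hc _ (S.stage_ge n) hle j) (hy n j)
    have hdiv : lam (S.stage n) ≤ lam (S.stage n) / (1 - alpha (S.stage n)) :=
      le_div_self hl0 (by linarith) (by linarith)
    have hηu : 0 ≤ u n + η (S.parent n) :=
      (add_nonneg (Finset.sum_nonneg fun i _ => hfX i) (Finset.sum_nonneg fun j _ => hcy j)).trans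
        (hr n hn)
    have e1 : 0 ≤ p n * ∑ i, (1 - lam (S.stage n)) * f (S.stage n) i * ∑ m ∈ S.path n, x m i :=
      mul_nonneg (hp n) (Finset.sum_nonneg fun i _ => by
        rw [mul_assoc]; exact mul_nonneg (by linarith) (hfX i))
    have e2 : 0 ≤ p n * ∑ j, (1 - lam (S.stage n)) * c (S.stage n) j * y n j :=
      mul_nonneg (hp n) (Finset.sum_nonneg fun j _ => by
        rw [mul_assoc]; exact mul_nonneg (by linarith) (hcy j))
    have e3 : 0 ≤ p n * (lam (S.stage n) * η (S.parent n)
        + lam (S.stage n) / (1 - alpha (S.stage n)) * u n) :=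
      mul_nonneg (hp n) (by
        have := mul_nonneg hl0 hηu
        have := mul_le_mul_of_nonneg_right hdiv (hu n hn)
        linarith)
    linarith

/-- The objective is monotone in the cumulative capacities and in `η`. -/
theorem FR_mono (hp : ∀ n, 0 ≤ p n) (hf : ∀ s, 1 ≤ s → s ≤ T → ∀ i, 0 ≤ f s i)
    (hlam : ∀ s, 2 ≤ s → s ≤ T → 0 ≤ lam s ∧ lam s ≤ 1)
    {x x' : S.Node → Fin M → ℝ} (y : S.Node → Fin J → ℝ) {η η' : S.Node → ℝ} (u : S.Node → ℝ)
    (hx : ∀ n i, ∑ m ∈ S.path n, x m i ≤ ∑ m ∈ S.path n, x' m i)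
    (hη : ∀ n, S.stage n ≠ T → η n ≤ η' n) :
    FR S p f c lam alpha x y η u ≤ FR S p f c lam alpha x' y η' u := by
  unfold FR
  refine Finset.sum_le_sum fun n _ => mul_le_mul_of_nonneg_left ?_ (hp n)
  have hle := S.stage_le n
  gcongr ?_ + _ + ?_ + _
  · refine Finset.sum_le_sum fun i _ => mul_le_mul_of_nonneg_left (hx n i) ?_
    split_ifs with hn
    · exact hf 1 le_rfl S.hT i
    · exact mul_nonneg (by linarith [(hlam _ (S.two_le_stage hn) hle).2])
        (hf _ (S.stage_ge n) hle i)
  · split_ifs with hn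
    · simp
    · have := S.stage_ge n
      exact mul_le_mul_of_nonneg_left (hη n hn) (hlam _ (by omega) (by omega)).1

/-- Difference of the objective at two tuples sharing `y` and `u`. -/
theorem FR_sub (hp1 : p S.root = 1) (x x' : S.Node → Fin M → ℝ) (y : S.Node → Fin J → ℝ)
    (η η' u : S.Node → ℝ) :
    FR S p f c lam alpha x y η u - FR S p f c lam alpha x' y η' u =
      (∑ i, f 1 i * (∑ m ∈ S.path S.root, x m i - ∑ m ∈ S.path S.root, x' m i))
      + (∑ n ∈ Finset.univ.filter (fun n => n ≠ S.root), p n * ((1 - lam (S.stage n)) *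
          ∑ i, f (S.stage n) i * (∑ m ∈ S.path n, x m i - ∑ m ∈ S.path n, x' m i)))
      + (∑ n ∈ Finset.univ.filter (fun n => S.stage n ≠ T),
          p n * lam (S.stage n + 1) * (η n - η' n)) := by
  have hroot : (∑ i, f 1 i * (∑ m ∈ S.path S.root, x m i - ∑ m ∈ S.path S.root, x' m i))
      = ∑ n, if n = S.root then
          p n * ∑ i, f 1 i * (∑ m ∈ S.path n, x m i - ∑ m ∈ S.path n, x' m i) else 0 := by
    rw [Finset.sum_ite_eq' Finset.univ S.root]
    simp [hp1]
  rw [hroot, Finset.sum_filter, Finset.sum_filter]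
  unfold FR
  rw [← Finset.sum_sub_distrib, ← Finset.sum_add_distrib, ← Finset.sum_add_distrib]
  refine Finset.sum_congr rfl fun n _ => ?_
  simp only [ne_eq, ite_not, mul_sub (f _ _)]
  split_ifs <;> simp only [mul_assoc (1 - lam _), ← Finset.mul_sum, Finset.sum_sub_distrib] <;> ring

end Objective

/-- Corollary 1: LP-based lower bound on the value of multistage
stochastic programming, built from an optimal solution `(x^L,y^L,η^L,u^L)` of the
LP relaxation of the two-stage model. -/
theorem vms_lower_bound_LP {T M N J : ℕ} (S : STree T)
    (p : S.Node → ℝ) (f : ℕ → Fin M → ℝ) (c : ℕ → Fin J → ℝ)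
    (A : ℕ → Matrix (Fin N) (Fin J) ℝ) (B : ℕ → Matrix (Fin M) (Fin J) ℝ)
    (d : S.Node → Fin N → ℝ) (lam alpha : ℕ → ℝ)
    (hp : ∀ n, 0 ≤ p n)
    (hp1 : ∀ s, 1 ≤ s → s ≤ T → ∑ n ∈ S.stageNodes s, p n = 1)
    (hpc : ∀ n, S.stage n ≠ T → ∑ m ∈ S.children n, p m = p n)
    (hf : ∀ s, 1 ≤ s → s ≤ T → ∀ i, 0 ≤ f s i)
    (hc : ∀ s, 1 ≤ s → s ≤ T → ∀ j, 0 ≤ c s j)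
    (hlam : ∀ s, 2 ≤ s → s ≤ T → 0 ≤ lam s ∧ lam s ≤ 1)
    (halpha : ∀ s, 2 ≤ s → s ≤ T → 0 ≤ alpha s ∧ alpha s < 1)
    (hB : ∀ s, 1 ≤ s → s ≤ T → ∀ i j, 0 ≤ B s i j)
    -- optimal solution of the LP relaxation of the two-stage model
    (xL : S.Node → Fin M → ℝ) (yL : S.Node → Fin J → ℝ) (etaL uL : S.Node → ℝ)
    (hLfeas : MFeasR S f c A B d xL yL etaL uL)
    (hLts : TSconstr S xL)
    (hLopt : ∀ (x : S.Node → Fin M → ℝ) (y : S.Node → Fin J → ℝ) (η u : S.Node → ℝ),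
      MFeasR S f c A B d x y η u → TSconstr S x →
      FR S p f c lam alpha xL yL etaL uL ≤ FR S p f c lam alpha x y η u)
    -- nonemptiness of the (integer) feasible sets
    (hMne : ∃ (x : S.Node → Fin M → ℤ) (y : S.Node → Fin J → ℝ) (η u : S.Node → ℝ),
      MFeasR S f c A B d (fun n i => (x n i : ℝ)) y η u)
    (hTne : ∃ (x : S.Node → Fin M → ℤ) (y : S.Node → Fin J → ℝ) (η u : S.Node → ℝ),
      MFeasR S f c A B d (fun n i => (x n i : ℝ)) y η u ∧
      TSconstr S (fun n i => (x n i : ℝ)))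
    -- constructed multistage (integer) and two-stage (fractional) solutions
    (xMS : S.Node → Fin M → ℤ) (xTS : S.Node → Fin M → ℝ) (etaMS etaTS : S.Node → ℝ)
    (hxMSr : ∀ i, xMS S.root i = ⌈bvec S B yL S.root i⌉)
    (hxMSn : ∀ n, n ≠ S.root → ∀ i,
      xMS n i = pmc S (bvec S B yL) n i - pmc S (bvec S B yL) (S.parent n) i)
    (hxTSr : ∀ i, xTS S.root i = bvec S B yL S.root i)
    (hxTSn : ∀ n, n ≠ S.root → ∀ i,
      xTS n i = pm S (stageMax S (bvec S B yL)) n i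
              - pm S (stageMax S (bvec S B yL)) (S.parent n) i)
    (hetaMS : ∀ n (hn : S.stage n ≠ T), etaMS n =
      (S.children n).sup' (S.children_nonempty hn) fun m =>
        (∑ i, f (S.stage m) i * ∑ l ∈ S.path m, (xMS l i : ℝ))
          + (∑ j, c (S.stage m) j * yL m j) - uL m)
    (hetaTS : ∀ n (hn : S.stage n ≠ T), etaTS n =
      (S.children n).sup' (S.children_nonempty hn) fun m =>
        (∑ i, f (S.stage m) i * ∑ l ∈ S.path m, xTS l i)
          + (∑ j, c (S.stage m) j * yL m j) - uL m) :
    (∑ i, f 1 i * (bvec S B yL S.root i - (⌈bvec S B yL S.root i⌉ : ℝ)))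
      + (∑ n ∈ Finset.univ.filter (fun n => n ≠ S.root),
          p n * ((1 - lam (S.stage n)) *
            ∑ i, f (S.stage n) i *
              (pm S (stageMax S (bvec S B yL)) n i - (pmc S (bvec S B yL) n i : ℝ))))
      + (∑ n ∈ Finset.univ.filter (fun n => S.stage n ≠ T),
          p n * lam (S.stage n + 1) * (etaTS n - etaMS n))
      ≤ zTS S p f c A B d lam alpha - zMS S p f c A B d lam alpha := by
  set b := bvec S B yL with hb
  obtain ⟨hx0, hy0, hu0, hA, hBy, hr⟩ := hLfeas
  have hp1' : p S.root = 1 := by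
    have := hp1 1 le_rfl S.hT
    rwa [S.stageNodes_one, Finset.sum_singleton] at this
  have hb0 : ∀ n i, 0 ≤ b n i := fun n i => by
    rw [hb, bvec, Matrix.mulVec, dotProduct]
    exact Finset.sum_nonneg fun j _ => mul_nonneg (hB _ (S.stage_ge n) (S.stage_le n) i j) (hy0 n j)
  have hTS : ∀ n i, ∑ m ∈ S.path n, xTS m i = pm S (stageMax S b) n i := fun n i =>
    S.sum_path_eq_of_increments (fun n => xTS n i) (fun n => pm S (stageMax S b) n i)
      (by rw [hxTSr, pm_root, stageMax_root]) (fun n hn => hxTSn n hn i) n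
  have hMS : ∀ n i, ∑ m ∈ S.path n, (xMS m i : ℝ) = pmc S b n i := fun n i => by
    exact_mod_cast S.sum_path_eq_of_increments (fun n => xMS n i) (fun n => pmc S b n i)
      (by rw [hxMSr, pmc_root]) (fun n hn => hxMSn n hn i) n
  have hX : ∀ n i, ∑ m ∈ S.path n, xTS m i ≤ ∑ m ∈ S.path n, xL m i := fun n i =>
    (hTS n i).le.trans (pm_stageMax_le_sum_path S b hx0 hLts hBy n i)
  have hetaTS_le : ∀ n, S.stage n ≠ T → etaTS n ≤ etaL n := fun n hn => by
    rw [hetaTS n hn]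
    refine Finset.sup'_le _ _ fun m hm => ?_
    obtain ⟨hmr, rfl⟩ := S.mem_children.mp hm
    have h1 := hr m hmr
    have h2 : (∑ i, f (S.stage m) i * ∑ l ∈ S.path m, xTS l i)
        ≤ ∑ i, f (S.stage m) i * ∑ l ∈ S.path m, xL l i := Finset.sum_le_sum fun i _ =>
      mul_le_mul_of_nonneg_left (hX m i) (hf _ (S.stage_ge m) (S.stage_le m) i)
    linarith
  have hzTS : FR S p f c lam alpha xTS yL etaTS uL ≤ zTS S p f c A B d lam alpha := by
    obtain ⟨x, y, η, u, h1, h2⟩ := hTne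
    refine le_csInf ⟨_, x, y, η, u, h1, h2, rfl⟩ ?_
    rintro v ⟨x, y, η, u, h1, h2, rfl⟩
    exact (FR_mono S hp hf hlam yL uL hX hetaTS_le).trans (hLopt _ y η u h1 h2)
  have hMSfeas : MFeasR S f c A B d (fun n i => (xMS n i : ℝ)) yL etaMS uL := by
    refine ⟨fun n i => ?_, hy0, hu0, hA, fun n i => ?_, fun n hn => ?_⟩
    · beta_reduce
      by_cases hn : n = S.root
      · subst hn
        rw [hxMSr]
        exact_mod_cast Int.ceil_nonneg (hb0 _ i)
      · rw [hxMSn n hn]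
        exact_mod_cast sub_nonneg.mpr (pmc_parent_le S b n i)
    · rw [hMS]
      exact le_pmc S b n i
    · rw [hetaMS _ (S.stage_parent_ne hn)]
      have := Finset.le_sup' (fun m => (∑ i, f (S.stage m) i * ∑ l ∈ S.path m, (xMS l i : ℝ))
          + (∑ j, c (S.stage m) j * yL m j) - uL m) (S.mem_children.mpr ⟨hn, rfl⟩)
      linarith
  have hzMS : zMS S p f c A B d lam alpha
      ≤ FR S p f c lam alpha (fun n i => (xMS n i : ℝ)) yL etaMS uL := by
    refine csInf_le ⟨0, ?_⟩ ⟨xMS, yL, etaMS, uL, hMSfeas, rfl⟩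
    rintro v ⟨x, y, η, u, h, rfl⟩
    exact FR_nonneg S hp hpc hf hc hlam halpha h
  have key := FR_sub S (f := f) (c := c) (lam := lam) (alpha := alpha) hp1' xTS
    (fun n i => (xMS n i : ℝ)) yL etaTS etaMS uL
  simp only [hTS, hMS, pm_root, pmc_root, stageMax_root] at key
  linarith
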